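/- Let R be a Noetherian local ring, I an ideal, 𝔑 = ⊕_{n≥0} N_n a finitely generated graded module over a finitely generated standard graded R-algebra with degree-0 part R. Let k ≥ -1 and let r be the eventual value of depth_k(I, N_n). Then for each integer l ≤ r, the set ⋃_{j≤l} {p ∈ Ass_R(H^j_I(N_n)) : dim(R/p) ≥ k} is finite and independent of n for all sufficiently large n. -/

import Mathlib

open CategoryTheory Opposite IsLocalRing

/-- Interpretation of an integer `k ≥ -1` in `WithBot ℕ∞`, for comparison with Krull dimensions. -/
noncomputable def zdim (k : ℤ) : WithBot (WithTop ℕ) :=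
  if k < 0 then ⊥ else ((k.toNat : WithTop ℕ) : WithBot (WithTop ℕ))

/-- The ideal generated by the first `j` entries of the sequence `x`. -/
def prefIdeal {R : Type} [CommRing R] {r : ℕ} (x : Fin r → R) (j : ℕ) : Ideal R :=
  Ideal.span (x '' {i | (i : ℕ) < j})

/-- `x` is an `N`-sequence in dimension `> k`: for each `i`, `x i` avoids every associated
prime `p` of `N/(x_0,…,x_{i-1})N` with `dim(R/p) > k`. -/
def IsSeqInDimGT (R : Type) [CommRing R] (N : Type) [AddCommGroup N] [Module R N]
    (k : ℤ) {r : ℕ} (x : Fin r → R) : Prop :=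
  ∀ i : Fin r, ∀ p ∈ associatedPrimes R (N ⧸ (prefIdeal x (i : ℕ) • ⊤ : Submodule R N)),
    zdim k < ringKrullDim (R ⧸ p) → x i ∉ p

/-- `depth_k(I,N)`: the common length of maximal `N`-sequences in dimension `> k`
contained in `I` (realized as the supremum of lengths of such sequences). -/
noncomputable def depthK (R : Type) [CommRing R] (k : ℤ) (I : Ideal R)
    (N : Type) [AddCommGroup N] [Module R N] : ℕ∞ :=
  sSup {n : ℕ∞ | ∃ (r : ℕ) (x : Fin r → R),
    (∀ i, x i ∈ I) ∧ IsSeqInDimGT R N k x ∧ n = (r : ℕ∞)}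

/-- The set of prime (or arbitrary) ideals `p` with `dim(R/p) ≥ k`. -/
def dimGE (R : Type) [CommRing R] (k : ℤ) : Set (Ideal R) :=
  {p | zdim k ≤ ringKrullDim (R ⧸ p)}

section LocalCohomology

open Limits

variable {R : Type} [CommRing R]

/-- The contravariant functor `Hom(-, Y)`, as a functor to the opposite category. -/
noncomputable abbrev homInto (Y : ModuleCat.{0} R) : ModuleCat.{0} R ⥤ (ModuleCat.{0} R)ᵒᵖ :=
  ((linearYoneda R (ModuleCat.{0} R)).obj Y).rightOp

/-- The natural transformation `homInto Z ⟶ homInto Y` induced by a map `Y ⟶ Z`. -/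
noncomputable abbrev homIntoMap {Y Z : ModuleCat.{0} R} (f : Y ⟶ Z) :
    homInto Z ⟶ homInto Y :=
  NatTrans.rightOp ((linearYoneda R (ModuleCat.{0} R)).map f)

/-- The short complex of complexes obtained by applying `Hom(P, -)` to a short complex. -/
noncomputable def homIntoSC (S : ShortComplex (ModuleCat.{0} R))
    (P : ChainComplex (ModuleCat.{0} R) ℕ) : ShortComplex (ChainComplex (ModuleCat.{0} R)ᵒᵖ ℕ) where
  X₁ := ((homInto S.X₃).mapHomologicalComplex _).obj P
  X₂ := ((homInto S.X₂).mapHomologicalComplex _).obj P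
  X₃ := ((homInto S.X₁).mapHomologicalComplex _).obj P
  f := (NatTrans.mapHomologicalComplex (homIntoMap S.g) _).app P
  g := (NatTrans.mapHomologicalComplex (homIntoMap S.f) _).app P
  zero := by
    ext i
    apply Quiver.Hom.unop_inj
    refine ModuleCat.hom_ext (LinearMap.ext fun (x : P.X i ⟶ S.X₁) => ?_)
    change (x ≫ S.f) ≫ S.g = 0
    simp

/-- Functoriality of `homIntoSC` in the complex. -/
noncomputable def homIntoSCMap (S : ShortComplex (ModuleCat.{0} R))
    {P Q : ChainComplex (ModuleCat.{0} R) ℕ} (φ : P ⟶ Q) : homIntoSC S P ⟶ homIntoSC S Q where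
  τ₁ := ((homInto S.X₃).mapHomologicalComplex _).map φ
  τ₂ := ((homInto S.X₂).mapHomologicalComplex _).map φ
  τ₃ := ((homInto S.X₁).mapHomologicalComplex _).map φ
  comm₁₂ := by simp [homIntoSC]
  comm₂₃ := by simp [homIntoSC]

instance preservesFiniteLimits_linearYoneda_obj (Y : ModuleCat.{0} R) :
    PreservesFiniteLimits ((linearYoneda R (ModuleCat.{0} R)).obj Y) := by
  have : PreservesFiniteLimits ((linearYoneda R (ModuleCat.{0} R)).obj Y ⋙ forget _) :=
    inferInstanceAs (PreservesFiniteLimits (yoneda.obj Y))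
  exact ⟨fun J _ _ => preservesLimitsOfShape_of_reflects_of_preserves _ (forget (ModuleCat.{0} R))⟩

lemma homIntoSC_shortExact {S : ShortComplex (ModuleCat.{0} R)} (hS : S.ShortExact)
    (P : ChainComplex (ModuleCat.{0} R) ℕ) [∀ i, Projective (P.X i)] :
    (homIntoSC S P).ShortExact := by
  apply HomologicalComplex.shortExact_of_degreewise_shortExact
  intro i
  let T : ShortComplex (ModuleCat.{0} R) :=
    { X₁ := ModuleCat.of R (P.X i ⟶ S.X₁)
      X₂ := ModuleCat.of R (P.X i ⟶ S.X₂)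
      X₃ := ModuleCat.of R (P.X i ⟶ S.X₃)
      f := ((linearYoneda R (ModuleCat.{0} R)).map S.f).app (op (P.X i))
      g := ((linearYoneda R (ModuleCat.{0} R)).map S.g).app (op (P.X i))
      zero := by
        refine ModuleCat.hom_ext (LinearMap.ext fun (x : P.X i ⟶ S.X₁) => ?_)
        change (x ≫ S.f) ≫ S.g = 0
        simp }
  have hT : T.ShortExact := by
    have := hS.mono_f
    have := hS.epi_g
    refine ShortComplex.ShortExact.mk' ?_ ?_ ?_
    · rw [ShortComplex.moduleCat_exact_iff]
      intro (x : P.X i ⟶ S.X₂) (hx : x ≫ S.g = 0)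
      exact ⟨hS.exact.lift x hx, hS.exact.lift_f x hx⟩
    · rw [ModuleCat.mono_iff_injective]
      intro (x : P.X i ⟶ S.X₁) (y : P.X i ⟶ S.X₁) (h : x ≫ S.f = y ≫ S.f)
      exact (cancel_mono _).1 h
    · rw [ModuleCat.epi_iff_surjective]
      intro (x : P.X i ⟶ S.X₃)
      exact ⟨Projective.factorThru x S.g, Projective.factorThru_comp x S.g⟩
  exact hT.op

instance preservesFiniteColimits_homInto (Y : ModuleCat.{0} R) :
    PreservesFiniteColimits (homInto Y) :=
  preservesFiniteColimits_rightOp _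

lemma exact_of_conj {D : Type*} [Category D] [HasZeroMorphisms D] {A B C A' B' C' : D}
    (a : A ≅ A') (b : B ≅ B') (c : C ≅ C') {f : A ⟶ B} {g : B ⟶ C} {f' : A' ⟶ B'} {g' : B' ⟶ C'}
    (hf : f = a.hom ≫ f' ≫ b.inv) (hg : g = b.hom ≫ g' ≫ c.inv) {w' : f' ≫ g' = 0}
    (h : (ShortComplex.mk f' g' w').Exact) : ∃ w, (ShortComplex.mk f g w).Exact := by
  have w : f ≫ g = 0 := by
    rw [hf, hg]
    simp [reassoc_of% w']
  exact ⟨w, ShortComplex.exact_of_iso (ShortComplex.isoMk a.symm b.symm c.symm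
    (by simp [hf]) (by simp [hg])) h⟩

lemma down_rel_succ (n : ℕ) : (ComplexShape.down ℕ).Rel (n + 1) n := rfl

/-- The derived functors of `homInto S.X₁` computed by a projective resolution. -/
noncomputable def derivedIso₁ (S : ShortComplex (ModuleCat.{0} R)) (X : ModuleCat.{0} R) (n : ℕ) :
    ((homInto S.X₁).leftDerived n).obj X ≅
      (homIntoSC S (projectiveResolution X).complex).X₃.homology n :=
  (projectiveResolution X).isoLeftDerivedObj (homInto S.X₁) n

/-- The derived functors of `homInto S.X₂` computed by a projective resolution. -/
noncomputable def derivedIso₂ (S : ShortComplex (ModuleCat.{0} R)) (X : ModuleCat.{0} R) (n : ℕ) :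
    ((homInto S.X₂).leftDerived n).obj X ≅
      (homIntoSC S (projectiveResolution X).complex).X₂.homology n :=
  (projectiveResolution X).isoLeftDerivedObj (homInto S.X₂) n

/-- The derived functors of `homInto S.X₃` computed by a projective resolution. -/
noncomputable def derivedIso₃ (S : ShortComplex (ModuleCat.{0} R)) (X : ModuleCat.{0} R) (n : ℕ) :
    ((homInto S.X₃).leftDerived n).obj X ≅
      (homIntoSC S (projectiveResolution X).complex).X₁.homology n :=
  (projectiveResolution X).isoLeftDerivedObj (homInto S.X₃) n

lemma leftDerived_app_f (S : ShortComplex (ModuleCat.{0} R)) (X : ModuleCat.{0} R) (n : ℕ) :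
    (NatTrans.leftDerived (homIntoMap S.f) n).app X = (derivedIso₂ S X n).hom ≫
      HomologicalComplex.homologyMap (homIntoSC S (projectiveResolution X).complex).g n ≫
        (derivedIso₁ S X n).inv :=
  ProjectiveResolution.leftDerived_app_eq _ _ _

lemma leftDerived_app_g (S : ShortComplex (ModuleCat.{0} R)) (X : ModuleCat.{0} R) (n : ℕ) :
    (NatTrans.leftDerived (homIntoMap S.g) n).app X = (derivedIso₃ S X n).hom ≫
      HomologicalComplex.homologyMap (homIntoSC S (projectiveResolution X).complex).f n ≫
        (derivedIso₂ S X n).inv :=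
  ProjectiveResolution.leftDerived_app_eq _ _ _

variable {S : ShortComplex (ModuleCat.{0} R)}

/-- The connecting homomorphism of `Ext` in the opposite category. -/
noncomputable def extδOp (hS : S.ShortExact) (X : ModuleCat.{0} R) (n : ℕ) :
    ((homInto S.X₁).leftDerived (n + 1)).obj X ⟶ ((homInto S.X₃).leftDerived n).obj X :=
  (derivedIso₁ S X (n + 1)).hom ≫
    (homIntoSC_shortExact hS (projectiveResolution X).complex).δ (n + 1) n (down_rel_succ n) ≫
      (derivedIso₃ S X n).inv

lemma extδOp_naturality (hS : S.ShortExact) {X X' : ModuleCat.{0} R} (f : X ⟶ X') (n : ℕ) :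
    ((homInto S.X₁).leftDerived (n + 1)).map f ≫ extδOp hS X' n =
      extδOp hS X n ≫ ((homInto S.X₃).leftDerived n).map f := by
  let φ := ProjectiveResolution.lift f (projectiveResolution X) (projectiveResolution X')
  have hφ : φ.f 0 ≫ (projectiveResolution X').π.f 0 = (projectiveResolution X).π.f 0 ≫ f :=
    ProjectiveResolution.lift_commutes_zero ..
  have h := HomologicalComplex.HomologySequence.δ_naturality (homIntoSCMap S φ)
    (homIntoSC_shortExact hS _) (homIntoSC_shortExact hS _) (n + 1) n (down_rel_succ n)
  have h1 : ((homInto S.X₁).leftDerived (n + 1)).map f ≫ (derivedIso₁ S X' (n + 1)).hom =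
      (derivedIso₁ S X (n + 1)).hom ≫ HomologicalComplex.homologyMap (homIntoSCMap S φ).τ₃ _ :=
    ProjectiveResolution.isoLeftDerivedObj_hom_naturality f _ _ φ hφ (homInto S.X₁) (n + 1)
  have h2 : (derivedIso₃ S X n).inv ≫ ((homInto S.X₃).leftDerived n).map f =
      HomologicalComplex.homologyMap (homIntoSCMap S φ).τ₁ _ ≫ (derivedIso₃ S X' n).inv :=
    ProjectiveResolution.isoLeftDerivedObj_inv_naturality f _ _ φ hφ (homInto S.X₃) n
  rw [extδOp, extδOp, Category.assoc, Category.assoc, h2, reassoc_of% h1, reassoc_of% h]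

lemma exact_derived₁ (hS : S.ShortExact) (X : ModuleCat.{0} R) (n : ℕ) :
    ∃ w, (ShortComplex.mk (extδOp hS X n)
      ((NatTrans.leftDerived (homIntoMap S.g) n).app X) w).Exact :=
  exact_of_conj _ _ _ rfl (leftDerived_app_g S X n)
    ((homIntoSC_shortExact hS (projectiveResolution X).complex).homology_exact₁ (n + 1) n
      (down_rel_succ n))

lemma exact_derived₂ (hS : S.ShortExact) (X : ModuleCat.{0} R) (n : ℕ) :
    ∃ w, (ShortComplex.mk ((NatTrans.leftDerived (homIntoMap S.g) n).app X)
      ((NatTrans.leftDerived (homIntoMap S.f) n).app X) w).Exact :=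
  exact_of_conj _ _ _ (leftDerived_app_g S X n) (leftDerived_app_f S X n)
    ((homIntoSC_shortExact hS (projectiveResolution X).complex).homology_exact₂ n)

lemma exact_derived₃ (hS : S.ShortExact) (X : ModuleCat.{0} R) (n : ℕ) :
    ∃ w, (ShortComplex.mk ((NatTrans.leftDerived (homIntoMap S.f) (n + 1)).app X)
      (extδOp hS X n) w).Exact :=
  exact_of_conj _ _ _ (leftDerived_app_f S X (n + 1)) rfl
    ((homIntoSC_shortExact hS (projectiveResolution X).complex).homology_exact₃ (n + 1) n
      (down_rel_succ n))

/-- The connecting homomorphism of `Ext` in the second variable. -/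
noncomputable def extδ (hS : S.ShortExact) (X : (ModuleCat.{0} R)ᵒᵖ) (n : ℕ) :
    ((Ext R (ModuleCat.{0} R) n).obj X).obj S.X₃ ⟶
      ((Ext R (ModuleCat.{0} R) (n + 1)).obj X).obj S.X₁ :=
  (extδOp hS X.unop n).unop

lemma extδ_naturality (hS : S.ShortExact) {X X' : (ModuleCat.{0} R)ᵒᵖ} (f : X ⟶ X') (n : ℕ) :
    ((Ext R (ModuleCat.{0} R) n).map f).app S.X₃ ≫ extδ hS X' n =
      extδ hS X n ≫ ((Ext R (ModuleCat.{0} R) (n + 1)).map f).app S.X₁ :=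
  (congrArg Quiver.Hom.unop (extδOp_naturality hS f.unop n)).symm

lemma ext_exact₂ (hS : S.ShortExact) (X : (ModuleCat.{0} R)ᵒᵖ) (n : ℕ) :
    Function.Exact (((Ext R (ModuleCat.{0} R) n).obj X).map S.f)
      (((Ext R (ModuleCat.{0} R) n).obj X).map S.g) := by
  obtain ⟨w, h⟩ := exact_derived₂ hS X.unop n
  exact (ShortComplex.ShortExact.moduleCat_exact_iff_function_exact _).1 h.unop

lemma ext_exact₃ (hS : S.ShortExact) (X : (ModuleCat.{0} R)ᵒᵖ) (n : ℕ) :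
    Function.Exact (((Ext R (ModuleCat.{0} R) n).obj X).map S.g) (extδ hS X n) := by
  obtain ⟨w, h⟩ := exact_derived₁ hS X.unop n
  exact (ShortComplex.ShortExact.moduleCat_exact_iff_function_exact _).1 h.unop

lemma ext_exact₁ (hS : S.ShortExact) (X : (ModuleCat.{0} R)ᵒᵖ) (n : ℕ) :
    Function.Exact (extδ hS X n) (((Ext R (ModuleCat.{0} R) (n + 1)).obj X).map S.f) := by
  obtain ⟨w, h⟩ := exact_derived₃ hS X.unop n
  exact (ShortComplex.ShortExact.moduleCat_exact_iff_function_exact _).1 h.unop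

lemma homologyFunctor_map_smul_id {D : Type*} [Category D] [Abelian D] [Linear R D] {ι : Type*}
    {c : ComplexShape ι} (K : HomologicalComplex D c) (r : R) (i : ι) :
    (HomologicalComplex.homologyFunctor D c i).map (r • 𝟙 K) = r • 𝟙 (K.homology i) := by
  have h : (HomologicalComplex.shortComplexFunctor D c i).map (r • 𝟙 K) = r • 𝟙 _ := by
    ext <;> rfl
  have h2 : (HomologicalComplex.homologyFunctor D c i).map (r • 𝟙 K) =
    ShortComplex.homologyMap ((HomologicalComplex.shortComplexFunctor D c i).map (r • 𝟙 K)) := rfl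
  rw [h2, h, ShortComplex.homologyMap_smul, ShortComplex.homologyMap_id]
  rfl

lemma conj_smul_id {D : Type*} [Category D] [Preadditive D] [Linear R D] {A B : D} (e : A ≅ B)
    (r : R) : e.hom ≫ (r • 𝟙 B) ≫ e.inv = r • 𝟙 A := by
  simp

/-- The `R`-linear structure on the opposite of the category of `R`-modules. -/
noncomputable local instance linearModuleCatOp : Linear R (ModuleCat.{0} R)ᵒᵖ where
  homModule X Y := (opEquiv X Y).module R
  smul_comp _ _ _ r f g := Quiver.Hom.unop_inj (Linear.comp_smul _ _ _ g.unop r f.unop)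
  comp_smul _ _ _ f r g := Quiver.Hom.unop_inj (Linear.smul_comp _ _ _ r g.unop f.unop)

lemma leftDerived_app_smul (X Y : ModuleCat.{0} R) (n : ℕ) (r : R) :
    (NatTrans.leftDerived (homIntoMap (r • 𝟙 Y)) n).app X = r • 𝟙 _ := by
  have h : (NatTrans.mapHomologicalComplex (homIntoMap (r • 𝟙 Y)) _).app
      (projectiveResolution X).complex = r • 𝟙 _ := by
    ext i
    apply Quiver.Hom.unop_inj
    refine ModuleCat.hom_ext (LinearMap.ext fun (x : _ ⟶ Y) => ?_)
    change x ≫ (r • 𝟙 Y) = r • x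
    simp
  rw [(projectiveResolution X).leftDerived_app_eq, h]
  rw [homologyFunctor_map_smul_id]
  exact conj_smul_id ((projectiveResolution X).isoLeftDerivedObj (homInto Y) n) r

lemma leftDerived_map_smul (X Y : ModuleCat.{0} R) (n : ℕ) (r : R) :
    ((homInto Y).leftDerived n).map (r • 𝟙 X) = r • 𝟙 _ := by
  have h : ((homInto Y).mapHomologicalComplex _).map
      (r • 𝟙 (projectiveResolution X).complex) = r • 𝟙 _ := by
    ext i
    apply Quiver.Hom.unop_inj
    refine ModuleCat.hom_ext (LinearMap.ext fun (x : _ ⟶ Y) => ?_)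
    change (r • 𝟙 _) ≫ x = r • x
    simp
  rw [Functor.leftDerived_map_eq (homInto Y) n (r • 𝟙 X) (P := projectiveResolution X)
    (Q := projectiveResolution X) (r • 𝟙 _) ?_]
  · dsimp only [Functor.comp_map]
    rw [h, homologyFunctor_map_smul_id]
    exact conj_smul_id ((projectiveResolution X).isoLeftDerivedObj (homInto Y) n) r
  · have hs : (HomologicalComplex.single (ModuleCat.{0} R) (ComplexShape.down ℕ) 0).map (r • 𝟙 X) =
        r • 𝟙 _ := by
      apply HomologicalComplex.from_single_hom_ext
      simp [HomologicalComplex.single_map_f_self]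
      rfl
    change _ = _ ≫ (HomologicalComplex.single (ModuleCat.{0} R) (ComplexShape.down ℕ) 0).map _
    rw [hs, Linear.smul_comp, Linear.comp_smul, Category.id_comp]
    exact congrArg _ (Category.comp_id _).symm

lemma leftDerived_map_zero (X Y : ModuleCat.{0} R) (n : ℕ) :
    ((homInto Y).leftDerived n).map (0 : X ⟶ X) = 0 := by
  have := leftDerived_map_smul X Y n 0
  rw [zero_smul] at this
  exact this.trans (zero_smul R (𝟙 (((homInto Y).leftDerived n).obj X)))

lemma ext_map_smul (X : (ModuleCat.{0} R)ᵒᵖ) (Y : ModuleCat.{0} R) (n : ℕ) (r : R)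
    (x : ((Ext R (ModuleCat.{0} R) n).obj X).obj Y) :
    ((Ext R (ModuleCat.{0} R) n).obj X).map (r • 𝟙 Y) x = r • x := by
  have h : ((Ext R (ModuleCat.{0} R) n).obj X).map (r • 𝟙 Y) = r • 𝟙 _ :=
    congrArg Quiver.Hom.unop (leftDerived_app_smul X.unop Y n r)
  rw [h]
  rfl

lemma ext_smul_eq_zero (X Y : ModuleCat.{0} R) (n : ℕ) (r : R) (hr : r • 𝟙 X = 0)
    (x : ((Ext R (ModuleCat.{0} R) n).obj (op X)).obj Y) : r • x = 0 := by
  have h := leftDerived_map_smul X Y n r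
  rw [hr, leftDerived_map_zero] at h
  have h2 : (0 : ((Ext R (ModuleCat.{0} R) n).obj (op X)).obj Y ⟶ _) = r • 𝟙 _ :=
    congrArg Quiver.Hom.unop h
  exact (congrArg (fun f => f.hom x) h2).symm

/-- `Ext` in degree zero is `Hom`. -/
noncomputable def extZeroIso (X : (ModuleCat.{0} R)ᵒᵖ) (Y : ModuleCat.{0} R) :
    ModuleCat.of R (X.unop ⟶ Y) ≅ ((Ext R (ModuleCat.{0} R) 0).obj X).obj Y :=
  ((homInto Y).leftDerivedZeroIsoSelf.app X.unop).unop

lemma extZeroIso_hom_naturality {X X' : (ModuleCat.{0} R)ᵒᵖ} (f : X ⟶ X') (Y : ModuleCat.{0} R)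
    (x : X.unop ⟶ Y) :
    ((Ext R (ModuleCat.{0} R) 0).map f).app Y ((extZeroIso X Y).hom x) =
      (extZeroIso X' Y).hom (f.unop ≫ x : X'.unop ⟶ Y) := by
  have := (congrArg Quiver.Hom.unop ((homInto Y).leftDerivedZeroIsoSelf.hom.naturality f.unop))
  exact (congrArg (fun g => g.hom x) this)

variable (I : Ideal R) (j : ℕ)

/-- The direct system of functors `Ext^j(R ⧸ I ^ t, -)` defining local cohomology. -/
noncomputable abbrev lcDiagram : (ℕᵒᵖ)ᵒᵖ ⥤ ModuleCat.{0} R ⥤ ModuleCat.{0} R :=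
  localCohomology.diagram (localCohomology.idealPowersDiagram I) j

/-- The structure map from a term of the direct system to local cohomology. -/
noncomputable def lcι (t : (ℕᵒᵖ)ᵒᵖ) : (lcDiagram I j).obj t ⟶ localCohomology I j :=
  colimit.ι (lcDiagram I j) t

/-- Local cohomology of `N` as a cocone on the direct system evaluated at `N`. -/
noncomputable def lcCocone (N : ModuleCat.{0} R) :
    Cocone (lcDiagram I j ⋙ (evaluation _ _).obj N) where
  pt := (localCohomology I j).obj N
  ι := { app := fun t => (lcι I j t).app N
         naturality := fun s t f => by
          have := congrArg (fun η => NatTrans.app η N) (colimit.w (lcDiagram I j) f)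
          exact this.trans (Category.comp_id _).symm }

/-- Local cohomology of `N` is the direct limit of the evaluated direct system. -/
noncomputable def lcIsColimit (N : ModuleCat.{0} R) : IsColimit (lcCocone I j N) :=
  isColimitOfPreserves ((evaluation _ _).obj N) (colimit.isColimit (lcDiagram I j))

variable {I j}

lemma lc_exists_rep {N : ModuleCat.{0} R} (x : (localCohomology I j).obj N) :
    ∃ (t : (ℕᵒᵖ)ᵒᵖ) (y : ((lcDiagram I j).obj t).obj N), (lcι I j t).app N y = x :=
  Concrete.isColimit_exists_rep _ (lcIsColimit I j N) x

lemma lc_exists_map_eq {N : ModuleCat.{0} R} {t : (ℕᵒᵖ)ᵒᵖ} (x y : ((lcDiagram I j).obj t).obj N)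
    (h : (lcι I j t).app N x = (lcι I j t).app N y) :
    ∃ (s : (ℕᵒᵖ)ᵒᵖ) (f : t ⟶ s), ((lcDiagram I j).map f).app N x =
      ((lcDiagram I j).map f).app N y := by
  obtain ⟨s, f, g, hfg⟩ := Concrete.isColimit_exists_of_rep_eq
    (lcDiagram I j ⋙ (evaluation _ _).obj N) (lcIsColimit I j N) x y h
  have : f = g := Quiver.Hom.unop_inj (Quiver.Hom.unop_inj (Subsingleton.elim _ _))
  subst this
  exact ⟨s, f, hfg⟩

lemma lc_w {N : ModuleCat.{0} R} {s t : (ℕᵒᵖ)ᵒᵖ} (f : s ⟶ t) (x : ((lcDiagram I j).obj s).obj N) :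
    (lcι I j t).app N (((lcDiagram I j).map f).app N x) = (lcι I j s).app N x := by
  have := congrArg (fun η => NatTrans.app η N) (colimit.w (lcDiagram I j) f)
  exact congrArg (fun g => g.hom x) this

lemma lcι_naturality {N N' : ModuleCat.{0} R} (g : N ⟶ N') (t : (ℕᵒᵖ)ᵒᵖ)
    (x : ((lcDiagram I j).obj t).obj N) :
    (localCohomology I j).map g ((lcι I j t).app N x) =
      (lcι I j t).app N' (((lcDiagram I j).obj t).map g x) :=
  (congrArg (fun g => g.hom x) ((lcι I j t).naturality g)).symm

lemma lcDiagram_naturality {N N' : ModuleCat.{0} R} (g : N ⟶ N') {s t : (ℕᵒᵖ)ᵒᵖ} (f : s ⟶ t)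
    (x : ((lcDiagram I j).obj s).obj N) :
    ((lcDiagram I j).obj t).map g (((lcDiagram I j).map f).app N x) =
      ((lcDiagram I j).map f).app N' (((lcDiagram I j).obj s).map g x) :=
  (congrArg (fun g => g.hom x) (((lcDiagram I j).map f).naturality g)).symm

/-- The connecting homomorphism on the terms of the direct system of local cohomology. -/
noncomputable def lcDiagramδ (hS : S.ShortExact) (t : (ℕᵒᵖ)ᵒᵖ) :
    ((lcDiagram I j).obj t).obj S.X₃ ⟶ ((lcDiagram I (j + 1)).obj t).obj S.X₁ :=
  extδ hS _ j

lemma lcDiagramδ_naturality (hS : S.ShortExact) {s t : (ℕᵒᵖ)ᵒᵖ} (f : s ⟶ t) :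
    ((lcDiagram I j).map f).app S.X₃ ≫ lcDiagramδ hS t =
      lcDiagramδ hS s ≫ ((lcDiagram I (j + 1)).map f).app S.X₁ :=
  extδ_naturality hS ((localCohomology.ringModIdeals
    (localCohomology.idealPowersDiagram I)).op.map f) j

lemma lcDiagramδ_map_apply (hS : S.ShortExact) {s t : (ℕᵒᵖ)ᵒᵖ} (f : s ⟶ t)
    (x : ((lcDiagram I j).obj s).obj S.X₃) :
    lcDiagramδ hS t (((lcDiagram I j).map f).app S.X₃ x) =
      ((lcDiagram I (j + 1)).map f).app S.X₁ (lcDiagramδ hS s x) :=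
  congrArg (fun g => g.hom x) (lcDiagramδ_naturality hS f)

lemma lcDiagram_exact₂ (hS : S.ShortExact) (t : (ℕᵒᵖ)ᵒᵖ) :
    Function.Exact (((lcDiagram I j).obj t).map S.f) (((lcDiagram I j).obj t).map S.g) :=
  ext_exact₂ hS _ j

lemma lcDiagram_exact₃ (hS : S.ShortExact) (t : (ℕᵒᵖ)ᵒᵖ) :
    Function.Exact (((lcDiagram I j).obj t).map S.g) (lcDiagramδ (I := I) (j := j) hS t) :=
  ext_exact₃ hS _ j

lemma lcDiagram_exact₁ (hS : S.ShortExact) (t : (ℕᵒᵖ)ᵒᵖ) :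
    Function.Exact (lcDiagramδ (I := I) (j := j) hS t) (((lcDiagram I (j + 1)).obj t).map S.f) :=
  ext_exact₁ hS _ j

variable (I) in
/-- The connecting homomorphism of local cohomology. -/
noncomputable def lcδ (hS : S.ShortExact) (j : ℕ) :
    (localCohomology I j).obj S.X₃ ⟶ (localCohomology I (j + 1)).obj S.X₁ :=
  (lcIsColimit I j S.X₃).desc
    { pt := (localCohomology I (j + 1)).obj S.X₁
      ι := { app := fun t => lcDiagramδ hS t ≫ (lcι I (j + 1) t).app S.X₁
             naturality := fun s t f => by
              have h3 : ((lcDiagram I j).map f).app S.X₃ ≫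
                  lcDiagramδ hS t ≫ (lcι I (j + 1) t).app S.X₁ =
                lcDiagramδ hS s ≫ (lcι I (j + 1) s).app S.X₁ := by
                rw [reassoc_of% (lcDiagramδ_naturality (I := I) (j := j) hS f)]
                exact congrArg (lcDiagramδ hS s ≫ ·) ((lcCocone I (j + 1) S.X₁).w f)
              exact h3.trans (Category.comp_id _).symm } }

lemma lcι_lcδ (hS : S.ShortExact) (t : (ℕᵒᵖ)ᵒᵖ) : (lcι I j t).app S.X₃ ≫ lcδ I hS j =
      lcDiagramδ hS t ≫ (lcι I (j + 1) t).app S.X₁ :=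
  (lcIsColimit I j S.X₃).fac _ t

lemma lcδ_lcι (hS : S.ShortExact) (t : (ℕᵒᵖ)ᵒᵖ) (x : ((lcDiagram I j).obj t).obj S.X₃) :
    lcδ I hS j ((lcι I j t).app S.X₃ x) = (lcι I (j + 1) t).app S.X₁ (lcDiagramδ hS t x) :=
  congrArg (fun g => g.hom x) (lcι_lcδ hS t)

lemma lc_exact₂ (hS : S.ShortExact) (j : ℕ) :
    Function.Exact ((localCohomology I j).map S.f) ((localCohomology I j).map S.g) := by
  intro x
  constructor
  · intro h
    obtain ⟨t, y, rfl⟩ := lc_exists_rep x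
    rw [lcι_naturality] at h
    obtain ⟨s, f, hf⟩ := lc_exists_map_eq _ 0 (h.trans (map_zero _).symm)
    rw [map_zero, ← lcDiagram_naturality] at hf
    obtain ⟨z, hz⟩ := (lcDiagram_exact₂ hS s _).1 hf
    refine ⟨(lcι I j s).app _ z, ?_⟩
    rw [lcι_naturality, ← lc_w f]
    exact congrArg _ hz
  · rintro ⟨y, rfl⟩
    have h : (localCohomology I j).map S.f ≫ (localCohomology I j).map S.g = 0 := by
      refine ModuleCat.hom_ext (LinearMap.ext fun x => ?_)
      obtain ⟨t, y, rfl⟩ := lc_exists_rep x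
      change (localCohomology I j).map S.g ((localCohomology I j).map S.f _) = 0
      rw [lcι_naturality, lcι_naturality]
      exact (congrArg _ ((lcDiagram_exact₂ hS t).apply_apply_eq_zero y)).trans (map_zero _)
    exact congrArg (fun g => g.hom y) h

lemma lc_exact₃ (hS : S.ShortExact) (j : ℕ) :
    Function.Exact ((localCohomology I j).map S.g) (lcδ I hS j) := by
  intro x
  constructor
  · intro h
    obtain ⟨t, y, rfl⟩ := lc_exists_rep x
    rw [lcδ_lcι] at h
    obtain ⟨s, f, hf⟩ := lc_exists_map_eq _ 0 (h.trans (map_zero _).symm)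
    rw [map_zero, ← lcDiagramδ_map_apply] at hf
    obtain ⟨z, hz⟩ := (lcDiagram_exact₃ hS s _).1 hf
    refine ⟨(lcι I j s).app _ z, ?_⟩
    rw [lcι_naturality, ← lc_w f]
    exact congrArg _ hz
  · rintro ⟨x, rfl⟩
    obtain ⟨t, y, rfl⟩ := lc_exists_rep x
    rw [lcι_naturality, lcδ_lcι]
    exact (congrArg _ ((lcDiagram_exact₃ hS t).apply_apply_eq_zero y)).trans (map_zero _)

lemma lc_exact₁ (hS : S.ShortExact) (j : ℕ) :
    Function.Exact (lcδ I hS j) ((localCohomology I (j + 1)).map S.f) := by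
  intro x
  constructor
  · intro h
    obtain ⟨t, y, rfl⟩ := lc_exists_rep x
    rw [lcι_naturality] at h
    obtain ⟨s, f, hf⟩ := lc_exists_map_eq _ 0 (h.trans (map_zero _).symm)
    rw [map_zero, ← lcDiagram_naturality] at hf
    obtain ⟨z, hz⟩ := (lcDiagram_exact₁ hS s _).1 hf
    refine ⟨(lcι I j s).app _ z, ?_⟩
    rw [lcδ_lcι, ← lc_w f]
    exact congrArg _ hz
  · rintro ⟨x, rfl⟩
    obtain ⟨t, y, rfl⟩ := lc_exists_rep x
    rw [lcδ_lcι, lcι_naturality]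
    exact (congrArg _ ((lcDiagram_exact₁ hS t).apply_apply_eq_zero y)).trans (map_zero _)

lemma lc_map_smul (N : ModuleCat.{0} R) (r : R) (x : (localCohomology I j).obj N) :
    (localCohomology I j).map (r • 𝟙 N) x = r • x := by
  obtain ⟨t, y, rfl⟩ := lc_exists_rep x
  rw [lcι_naturality]
  exact (congrArg _ (ext_map_smul _ N j r y)).trans (map_smul _ _ _)

lemma lc_exists_pow_smul_eq_zero {N : ModuleCat.{0} R} (x : (localCohomology I j).obj N) :
    ∃ t : ℕ, ∀ r ∈ I ^ t, r • x = 0 := by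
  obtain ⟨t, y, rfl⟩ := lc_exists_rep x
  refine ⟨t.unop.unop, fun r hr => ?_⟩
  refine (map_smul ((lcι I j t).app N).hom r y).symm.trans ?_
  refine (congrArg _ (ext_smul_eq_zero _ N j r ?_ y)).trans (map_zero _)
  refine ModuleCat.hom_ext (Submodule.linearMap_qext _ (LinearMap.ext fun a => ?_))
  exact (Submodule.Quotient.mk_eq_zero _).2 (Ideal.mul_mem_right a _ hr)

lemma eq_zero_of_ext_map_eq_zero {X X' : (ModuleCat.{0} R)ᵒᵖ} (f : X ⟶ X') {Y : ModuleCat.{0} R}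
    (x : X.unop ⟶ Y) (h : ((Ext R (ModuleCat.{0} R) 0).map f).app Y ((extZeroIso X Y).hom x) = 0) :
    (f.unop ≫ x : X'.unop ⟶ Y) = 0 := by
  rw [extZeroIso_hom_naturality] at h
  exact (ConcreteCategory.bijective_of_isIso (extZeroIso X' Y).hom).1 (h.trans (map_zero _).symm)

variable (I) in
/-- Homomorphisms out of `R ⧸ I ^ t` as the terms of the direct system of local cohomology in
degree zero. -/
noncomputable def lcDiagramZeroIso (t : (ℕᵒᵖ)ᵒᵖ) (N : ModuleCat.{0} R) :
    ModuleCat.of R (ModuleCat.of R (R ⧸ I ^ t.unop.unop) ⟶ N) ≅ ((lcDiagram I 0).obj t).obj N :=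
  extZeroIso (op (ModuleCat.of R (R ⧸ I ^ t.unop.unop))) N

lemma hom_eq_zero_iff {N : ModuleCat.{0} R} (J : Ideal R) (φ : ModuleCat.of R (R ⧸ J) ⟶ N) :
    φ = 0 ↔ φ (Ideal.Quotient.mk J 1) = 0 := by
  constructor
  · rintro rfl
    rfl
  · intro h
    refine ModuleCat.hom_ext (Submodule.linearMap_qext _ (LinearMap.ext_ring ?_))
    exact h

lemma eq_zero_of_lcDiagram_map_eq_zero {N : ModuleCat.{0} R} {s t : (ℕᵒᵖ)ᵒᵖ} (f : s ⟶ t)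
    (φ : ModuleCat.of R (R ⧸ I ^ s.unop.unop) ⟶ N)
    (h : ((lcDiagram I 0).map f).app N ((lcDiagramZeroIso I s N).hom φ) = 0) : φ = 0 := by
  have h2 := eq_zero_of_ext_map_eq_zero ((localCohomology.ringModIdeals
        (localCohomology.idealPowersDiagram I)).op.map f) φ h
  rw [hom_eq_zero_iff]
  exact congrArg (fun g => g.hom (Ideal.Quotient.mk (I ^ t.unop.unop) 1)) h2

variable (I) in
/-- The class in degree zero local cohomology of a homomorphism out of `R ⧸ I ^ t`. -/
noncomputable def lcZero {N : ModuleCat.{0} R} (t : (ℕᵒᵖ)ᵒᵖ)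
    (φ : ModuleCat.of R (R ⧸ I ^ t.unop.unop) ⟶ N) : (localCohomology I 0).obj N :=
  (lcι I 0 t).app N ((lcDiagramZeroIso I t N).hom φ)

lemma lcZero_smul {N : ModuleCat.{0} R} (t : (ℕᵒᵖ)ᵒᵖ) (a : R)
    (φ : ModuleCat.of R (R ⧸ I ^ t.unop.unop) ⟶ N) : lcZero I t (a • φ) = a • lcZero I t φ :=
  (congrArg ((lcι I 0 t).app N) (map_smul (lcDiagramZeroIso I t N).hom.hom a φ)).trans
      (map_smul ((lcι I 0 t).app N).hom a _)

lemma lcZero_zero {N : ModuleCat.{0} R} (t : (ℕᵒᵖ)ᵒᵖ) : lcZero I (N := N) t 0 = 0 :=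
  (congrArg ((lcι I 0 t).app N) (map_zero (lcDiagramZeroIso I t N).hom.hom)).trans
      (map_zero ((lcι I 0 t).app N).hom)

lemma lcZero_eq_zero_iff {N : ModuleCat.{0} R} (t : (ℕᵒᵖ)ᵒᵖ)
    (φ : ModuleCat.of R (R ⧸ I ^ t.unop.unop) ⟶ N) :
    lcZero I t φ = 0 ↔ φ (Ideal.Quotient.mk _ 1) = 0 := by
  rw [← hom_eq_zero_iff]
  constructor
  · intro h
    obtain ⟨s, f, hf⟩ := lc_exists_map_eq
      ((lcDiagramZeroIso I t N).hom φ) 0 (h.trans (map_zero ((lcι I 0 t).app N).hom).symm)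
    exact eq_zero_of_lcDiagram_map_eq_zero f φ
      (hf.trans (map_zero (((lcDiagram I 0).map f).app N).hom))
  · rintro rfl
    exact lcZero_zero t

lemma exists_lcZero_eq {N : ModuleCat.{0} R} (x : (localCohomology I 0).obj N) :
    ∃ t φ, lcZero I t φ = x := by
  obtain ⟨t, y, rfl⟩ := lc_exists_rep x
  obtain ⟨φ, rfl⟩ := (ConcreteCategory.bijective_of_isIso (lcDiagramZeroIso I t N).hom).2 y
  exact ⟨_, φ, rfl⟩

lemma mem_associatedPrimes_iff_smul [IsNoetherianRing R] {M : Type*} [AddCommGroup M] [Module R M]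
    {p : Ideal R} : p ∈ associatedPrimes R M ↔ p.IsPrime ∧ ∃ x : M, ∀ a, a ∈ p ↔ a • x = 0 := by
  rw [AssociatedPrimes.mem_iff, isAssociatedPrime_iff]
  simp only [Ideal.ext_iff, Submodule.mem_colon_singleton, Submodule.mem_bot]

lemma mem_associatedPrimes_lc_zero_iff [IsNoetherianRing R] {N : ModuleCat.{0} R} {p : Ideal R}
    (hp : I ≤ p) :
    p ∈ associatedPrimes R ((localCohomology I 0).obj N) ↔ p ∈ associatedPrimes R N := by
  rw [mem_associatedPrimes_iff_smul, mem_associatedPrimes_iff_smul]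
  refine and_congr_right fun _ => ?_
  constructor
  · rintro ⟨x, hx⟩
    obtain ⟨t, φ, rfl⟩ := exists_lcZero_eq x
    refine ⟨φ (Ideal.Quotient.mk _ 1), fun a => ?_⟩
    rw [hx, ← lcZero_smul, lcZero_eq_zero_iff]
    rfl
  · rintro ⟨x, hx⟩
    let φ : ModuleCat.of R (R ⧸ I ^ 1) ⟶ N := ModuleCat.ofHom
      (Submodule.liftQ _ (LinearMap.toSpanSingleton R N x) fun a ha => by
        rw [pow_one] at ha
        exact (hx a).1 (hp ha))
    have hφ : φ (Ideal.Quotient.mk _ 1) = x := by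
      change (1 : R) • x = x
      simp
    refine ⟨lcZero I (op (op 1)) φ, fun a => ?_⟩
    rw [hx, ← lcZero_smul, lcZero_eq_zero_iff, ← hφ]
    rfl

section Maps

variable (I : Ideal R) (j : ℕ) {A B C : Type} [AddCommGroup A] [AddCommGroup B] [AddCommGroup C]
  [Module R A] [Module R B] [Module R C]

/-- The map on local cohomology induced by a linear map. -/
noncomputable def lcMap (f : A →ₗ[R] B) : (localCohomology I j).obj (ModuleCat.of R A) →ₗ[R]
    (localCohomology I j).obj (ModuleCat.of R B) :=
  ((localCohomology I j).map (ModuleCat.ofHom f)).hom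

lemma lcMap_comp_apply (g : B →ₗ[R] C) (f : A →ₗ[R] B)
    (x : (localCohomology I j).obj (ModuleCat.of R A)) :
    lcMap I j (g ∘ₗ f) x = lcMap I j g (lcMap I j f x) := by
  have := (localCohomology I j).map_comp (ModuleCat.ofHom f) (ModuleCat.ofHom g)
  exact congrArg (fun g => g.hom x) this

lemma lcMap_smul_id (r : R) (x : (localCohomology I j).obj (ModuleCat.of R A)) :
    lcMap I j (r • LinearMap.id : A →ₗ[R] A) x = r • x :=
  lc_map_smul (ModuleCat.of R A) r x

variable {I} in
lemma lc_smul_eq_zero {s : R} (hs : ∀ a : A, s • a = 0)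
    (x : (localCohomology I j).obj (ModuleCat.of R A)) : s • x = 0 := by
  have h : (s • LinearMap.id : A →ₗ[R] A) = (0 : R) • LinearMap.id := by
    ext a
    simp [hs]
  rw [← lcMap_smul_id, h, lcMap_smul_id, zero_smul]

variable {I} in
lemma le_of_mem_associatedPrimes_lc [IsNoetherianRing R] {N : ModuleCat.{0} R} {p : Ideal R}
    (hp : p ∈ associatedPrimes R ((localCohomology I j).obj N)) : I ≤ p := by
  obtain ⟨hp, x, hx⟩ := mem_associatedPrimes_iff_smul.1 hp
  obtain ⟨t, ht⟩ := lc_exists_pow_smul_eq_zero x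
  exact hp.le_of_pow_le fun r hr => (hx r).2 (ht r hr)

variable {j} in
lemma exists_lc_connecting {f : A →ₗ[R] B} {g : B →ₗ[R] C} (hf : Function.Injective f)
    (hfg : Function.Exact f g) (hg : Function.Surjective g) :
    ∃ δ : (localCohomology I j).obj (ModuleCat.of R C) →ₗ[R]
      (localCohomology I (j + 1)).obj (ModuleCat.of R A),
      Function.Exact (lcMap I j f) (lcMap I j g) ∧ Function.Exact (lcMap I j g) δ ∧
        Function.Exact δ (lcMap I (j + 1) f) := by
  let S : ShortComplex (ModuleCat.{0} R) := ShortComplex.mk (ModuleCat.ofHom f) (ModuleCat.ofHom g)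
    (ModuleCat.hom_ext (LinearMap.ext fun x => hfg.apply_apply_eq_zero x))
  have hS : S.ShortExact := ShortComplex.ShortExact.mk'
    ((ShortComplex.ShortExact.moduleCat_exact_iff_function_exact S).2 hfg)
    ((ModuleCat.mono_iff_injective _).2 hf) ((ModuleCat.epi_iff_surjective _).2 hg)
  exact ⟨(lcδ I hS j).hom, lc_exact₂ hS j, lc_exact₃ hS j, lc_exact₁ hS j⟩

end Maps

section AssociatedPrimes

variable {X : Type*} [AddCommGroup X] [Module R X]

lemma exists_smul_eq_zero_of_associatedPrimes [IsNoetherianRing R] {p : Ideal R} [p.IsPrime]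
    (h : ∀ q ∈ associatedPrimes R X, ¬ q ≤ p) (z : X) : ∃ s ∉ p, s • z = 0 := by
  by_contra! hz
  have hle : (⊥ : Submodule R X).colon {z} ≤ p := by
    intro a ha
    by_contra hap
    exact hz a hap (by simpa [Submodule.mem_colon_singleton] using ha)
  obtain ⟨q, hq, hqp⟩ := Ideal.exists_minimalPrimes_le hle
  obtain ⟨y, hy⟩ := Submodule.exists_eq_colon_of_mem_minimalPrimes hq
  exact h q ((isAssociatedPrime_iff).2 ⟨hq.1.1, y, hy⟩) hqp

lemma exists_mem_annihilator_notMem {p : Ideal R} [p.IsPrime] {N : Submodule R X} (hN : N.FG)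
    (h : ∀ z ∈ N, ∃ s ∉ p, s • z = 0) : ∃ s ∉ p, ∀ z ∈ N, s • z = 0 := by
  classical
  obtain ⟨G, rfl⟩ := hN
  choose! s hs using h
  refine ⟨∏ g ∈ G, s g, fun hp => ?_, fun z hz => ?_⟩
  · obtain ⟨g, hg, hgp⟩ := (Ideal.IsPrime.prod_mem_iff).1 hp
    exact (hs g (Submodule.subset_span hg)).1 hgp
  · induction hz using Submodule.span_induction with
    | mem g hg =>
      rw [← Finset.prod_erase_mul _ _ hg, mul_smul, (hs g (Submodule.subset_span hg)).2, smul_zero]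
    | zero => simp
    | add y z _ _ hy hz => rw [smul_add, hy, hz, add_zero]
    | smul a z _ hz => rw [smul_comm, hz, smul_zero]

lemma mem_associatedPrimes_of_smul [IsNoetherianRing R] {p : Ideal R} [hp : p.IsPrime] (c : X)
    (h1 : ∀ a ∈ p, ∃ s ∉ p, s • a • c = 0) (h2 : ∀ s ∉ p, s • c ≠ 0) :
    p ∈ associatedPrimes R X := by
  obtain ⟨s, hs, hsp⟩ := exists_mem_annihilator_notMem (p := p)
    (N := Submodule.map (LinearMap.toSpanSingleton R X c) p) ((IsNoetherian.noetherian p).map _) (by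
      rintro _ ⟨a, ha, rfl⟩
      exact h1 a ha)
  refine mem_associatedPrimes_iff_smul.2 ⟨hp, s • c, fun a => ⟨fun ha => ?_, fun ha => ?_⟩⟩
  · rw [smul_comm]
    exact hsp _ ⟨a, ha, rfl⟩
  · by_contra hap
    refine h2 (a * s) (fun h => (hp.mem_or_mem h).elim hap hs) ?_
    rw [mul_smul, ha]

end AssociatedPrimes

section Comparison

variable [IsNoetherianRing R]

/-- One step of the comparison: replace `A` by `B ≅ A / x A`. -/
lemma exists_mem_associatedPrimes_lc_iff_of_quotient {A B : Type} [AddCommGroup A]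
    [AddCommGroup B] [Module R A] [Module R B] [Module.Finite R A] (I : Ideal R) (l : ℕ)
    (π : A →ₗ[R] B) (hπ : Function.Surjective π) (x : R)
    (hker : Function.Exact (x • LinearMap.id : A →ₗ[R] A) π) (hxI : x ∈ I) (p : Ideal R)
    [hp : p.IsPrime] (hIp : I ≤ p) (hx : ∀ q ∈ associatedPrimes R A, q < p → x ∉ q)
    (hpA : p ∉ associatedPrimes R A)
    (hlc : ∀ j ≤ l, ∀ q < p,
      q ∉ associatedPrimes R ((localCohomology I j).obj (ModuleCat.of R A))) :
    (∃ j ≤ l + 1, p ∈ associatedPrimes R ((localCohomology I j).obj (ModuleCat.of R A))) ↔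
      ∃ j ≤ l, p ∈ associatedPrimes R ((localCohomology I j).obj (ModuleCat.of R B)) := by
  set m : A →ₗ[R] A := x • LinearMap.id with hm
  have htors : ∀ j ≤ l, p ∉ associatedPrimes R ((localCohomology I j).obj (ModuleCat.of R A)) →
      ∀ w : (localCohomology I j).obj (ModuleCat.of R A), ∃ s ∉ p, s • w = 0 := by
    intro j hj hpj w
    refine exists_smul_eq_zero_of_associatedPrimes (fun q hq hqp => ?_) w
    rcases hqp.eq_or_lt with rfl | hlt
    · exact hpj hq
    · exact hlc j hj q hlt hq
  obtain ⟨s, hsp, hs⟩ : ∃ s ∉ p, ∀ a ∈ LinearMap.ker m, s • a = 0 := by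
    refine exists_mem_annihilator_notMem (IsNoetherian.noetherian _) fun a ha => ?_
    have hT : ∀ q ∈ associatedPrimes R (LinearMap.ker m), ¬ q ≤ p := by
      intro q hq hqp
      have hqA : q ∈ associatedPrimes R A :=
        associatedPrimes.subset_of_injective (LinearMap.ker m).injective_subtype hq
      rcases hqp.eq_or_lt with rfl | hlt
      · exact hpA hqA
      · obtain ⟨_, y, hy⟩ := mem_associatedPrimes_iff_smul.1 hq
        exact hx q hqA hlt ((hy x).2 (Subtype.ext y.2))
    obtain ⟨s, hs, h⟩ := exists_smul_eq_zero_of_associatedPrimes hT ⟨a, ha⟩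
    exact ⟨s, hs, congrArg Subtype.val h⟩
  have hsT : ∀ j (v : (localCohomology I j).obj (ModuleCat.of R (LinearMap.ker m))), s • v = 0 :=
    fun j v => lc_smul_eq_zero j (fun a => Subtype.ext (hs a a.2)) v
  have hTU : Function.Exact (LinearMap.ker m).subtype m.rangeRestrict := by
    rw [LinearMap.exact_iff, LinearMap.ker_rangeRestrict, Submodule.range_subtype]
  have hUB : Function.Exact (LinearMap.range m).subtype π := by
    rw [LinearMap.exact_iff, Submodule.range_subtype]
    exact LinearMap.exact_iff.1 hker
  have hcomp : ∀ j (z : (localCohomology I j).obj (ModuleCat.of R A)),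
      lcMap I j (LinearMap.range m).subtype (lcMap I j m.rangeRestrict z) = x • z := by
    intro j z
    rw [← lcMap_comp_apply, ← lcMap_smul_id]
    rfl
  constructor
  · intro hex
    classical
    obtain ⟨hj, hpj⟩ := Nat.find_spec hex
    have hmin := fun j => @Nat.find_min _ _ hex j
    generalize Nat.find hex = j at hj hpj hmin
    rcases j with _ | i
    · exact absurd ((mem_associatedPrimes_lc_zero_iff hIp).1 hpj) hpA
    have hil : i ≤ l := by omega
    have hti := htors i hil (fun h => hmin i (by omega) ⟨by omega, h⟩)
    obtain ⟨_, z, hz⟩ := mem_associatedPrimes_iff_smul.1 hpj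
    obtain ⟨δ, -, h3, h1⟩ := exists_lc_connecting I (j := i)
      (LinearMap.range m).injective_subtype hUB hπ
    obtain ⟨δ', h2', -, -⟩ := exists_lc_connecting I (j := i + 1)
      (LinearMap.ker m).injective_subtype hTU m.surjective_rangeRestrict
    obtain ⟨c, hc⟩ := (h1 (lcMap I (i + 1) m.rangeRestrict z)).1 (by
      rw [hcomp]
      exact (hz x).1 (hIp hxI))
    refine ⟨i, hil, mem_associatedPrimes_of_smul c (fun a ha => ?_) (fun a ha h => ?_)⟩
    · obtain ⟨w, hw⟩ := (h3 (a • c)).1 (by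
        rw [map_smul, hc, ← map_smul, (hz a).1 ha, map_zero])
      obtain ⟨s', hs', h⟩ := hti w
      exact ⟨s', hs', by rw [← hw, ← map_smul, h, map_zero]⟩
    · obtain ⟨v, hv⟩ := (h2' (a • z)).1 (by
        rw [map_smul, ← hc, ← map_smul, h, map_zero])
      have : (s * a) • z = 0 := by
        rw [mul_smul, ← hv, ← map_smul, hsT, map_zero]
      exact (hp.mem_or_mem ((hz _).2 this)).elim hsp ha
  · rintro ⟨j, hj, hpj⟩
    by_contra! hcon
    have htj := htors j hj (hcon j (by omega))
    obtain ⟨_, c, hc⟩ := mem_associatedPrimes_iff_smul.1 hpj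
    obtain ⟨δ, -, h3, -⟩ := exists_lc_connecting I (j := j)
      (LinearMap.range m).injective_subtype hUB hπ
    obtain ⟨δ', h2', h3', -⟩ := exists_lc_connecting I (j := j + 1)
      (LinearMap.ker m).injective_subtype hTU m.surjective_rangeRestrict
    obtain ⟨z, hz⟩ := (h3' (s • δ c)).1 (by rw [map_smul, hsT])
    refine hcon (j + 1) (by omega) (mem_associatedPrimes_of_smul z (fun a ha => ?_)
      (fun a ha h => ?_))
    · obtain ⟨v, hv⟩ := (h2' (a • z)).1 (by
        rw [map_smul, hz, smul_comm, ← map_smul, (hc a).1 ha, map_zero, smul_zero])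
      exact ⟨s, hsp, by rw [← hv, ← map_smul, hsT, map_zero]⟩
    · obtain ⟨w, hw⟩ := (h3 ((a * s) • c)).1 (by
        rw [map_smul, mul_smul, ← hz, ← map_smul, h, map_zero])
      obtain ⟨s', hs', h'⟩ := htj w
      have : (s' * (a * s)) • c = 0 := by
        rw [mul_smul, ← hw, ← map_smul, h', map_zero]
      exact (hp.mem_or_mem ((hc _).2 this)).elim hs'
        fun h => (hp.mem_or_mem h).elim ha hsp

/-- Associated primes of local cohomology in degrees `≤ l`, in terms of successive quotients by a
sequence which is regular in the relevant range. -/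
theorem exists_mem_associatedPrimes_lc_iff (I : Ideal R) (l : ℕ) (N : ℕ → Type)
    [∀ i, AddCommGroup (N i)] [∀ i, Module R (N i)] [∀ i, Module.Finite R (N i)]
    (π : ∀ i, N i →ₗ[R] N (i + 1)) (x : ℕ → R) (hπ : ∀ i, Function.Surjective (π i))
    (hker : ∀ i, Function.Exact (x i • LinearMap.id : N i →ₗ[R] N i) (π i))
    (hxI : ∀ i < l, x i ∈ I) (p : Ideal R) [hp : p.IsPrime] (hIp : I ≤ p)
    (hx : ∀ i < l, ∀ q ∈ associatedPrimes R (N i), q < p → x i ∉ q) :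
    (∃ j ≤ l, p ∈ associatedPrimes R ((localCohomology I j).obj (ModuleCat.of R (N 0)))) ↔
      ∃ j ≤ l, p ∈ associatedPrimes R (N j) := by
  induction l generalizing N x p with
  | zero =>
    simp only [nonpos_iff_eq_zero, exists_eq_left]
    exact mem_associatedPrimes_lc_zero_iff hIp
  | succ l ih =>
    by_cases hpN : p ∈ associatedPrimes R (N 0)
    · exact iff_of_true ⟨0, by omega, (mem_associatedPrimes_lc_zero_iff hIp).2 hpN⟩
        ⟨0, by omega, hpN⟩
    · have hlc : ∀ j ≤ l, ∀ q < p,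
          q ∉ associatedPrimes R ((localCohomology I j).obj (ModuleCat.of R (N 0))) := by
        intro j hj q hqp hq
        have : q.IsPrime := hq.1
        have hIq := le_of_mem_associatedPrimes_lc j hq
        obtain ⟨i, hi, hqi⟩ := (ih N π x hπ hker (fun i hi => hxI i (by omega)) q hIq
          (fun i hi q' hq' hlt => hx i (by omega) q' hq' (hlt.trans hqp))).1 ⟨j, hj, hq⟩
        exact hx i (by omega) q hqi hqp (hIq (hxI i (by omega)))
      rw [exists_mem_associatedPrimes_lc_iff_of_quotient I l (π 0) (hπ 0) (x 0) (hker 0)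
        (hxI 0 (by omega)) p hIp (hx 0 (by omega)) hpN hlc,
        ih (fun i => N (i + 1)) (fun i => π (i + 1)) (fun i => x (i + 1)) (fun i => hπ (i + 1))
        (fun i => hker (i + 1)) (fun i hi => hxI (i + 1) (by omega)) p hIp
        (fun i hi => hx (i + 1) (by omega))]
      constructor
      · rintro ⟨j, hj, h⟩
        exact ⟨j + 1, by omega, h⟩
      · rintro ⟨j, hj, h⟩
        rcases j with _ | j
        · exact absurd h hpN
        · exact ⟨j, by omega, h⟩

end Comparison

end LocalCohomology

section Graded

variable {R : Type} [CommRing R]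

variable [IsNoetherianRing R] {S : Type*} [CommRing S] [Algebra R S]
  {E : Type*} [AddCommGroup E] [Module R E] [Module S E] [IsScalarTower R S E]

lemma associatedPrimes_subset_image_comap [IsNoetherianRing S] :
    associatedPrimes R E ⊆ Ideal.comap (algebraMap R S) '' associatedPrimes S E := by
  intro p hp
  obtain ⟨hp, e, he⟩ := mem_associatedPrimes_iff_smul.1 hp
  have h : ((⊥ : Submodule S E).colon {e}).comap (algebraMap R S) = p := by
    ext a
    simp [Submodule.mem_colon_singleton, he]
  obtain ⟨P, hP, rfl⟩ := Ideal.exists_minimalPrimes_comap_eq (f := algebraMap R S)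
    (I := (⊥ : Submodule S E).colon {e}) p (by
      rw [h, Ideal.minimalPrimes_eq_subsingleton_self]
      rfl)
  obtain ⟨y, hy⟩ := Submodule.exists_eq_colon_of_mem_minimalPrimes hP
  exact ⟨P, isAssociatedPrime_iff.2 ⟨hP.1.1, y, hy⟩, rfl⟩

lemma finite_associatedPrimes_of_finite_algebra [IsNoetherianRing S] [Module.Finite S E] :
    (associatedPrimes R E).Finite :=
  ((associatedPrimes.finite S E).image _).subset associatedPrimes_subset_image_comap

variable (E) in
/-- The elements of `E` killed by `A`. -/
def killedBy (A : Set S) : Submodule S E where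
  carrier := {e | ∀ a ∈ A, a • e = 0}
  add_mem' h h' a ha := by rw [smul_add, h a ha, h' a ha, add_zero]
  zero_mem' a _ := smul_zero a
  smul_mem' s e h a ha := by rw [smul_comm, h a ha, smul_zero]

lemma isNoetherian_killedBy [IsNoetherianRing S] [Module.Finite S E] {A : Set S}
    (hA : Algebra.adjoin R A = ⊤) : IsNoetherian R (killedBy E A) := by
  have hs : ∀ s : S, ∃ r : R, ∀ e ∈ killedBy E A, s • e = r • e := by
    intro s
    have hs : s ∈ Algebra.adjoin R A := hA ▸ Algebra.mem_top
    induction hs using Algebra.adjoin_induction with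
    | mem a ha => exact ⟨0, fun e he => by rw [he a ha, zero_smul]⟩
    | algebraMap r => exact ⟨r, fun e _ => algebraMap_smul S r e⟩
    | add s t _ _ hs ht =>
      obtain ⟨r, hr⟩ := hs
      obtain ⟨r', hr'⟩ := ht
      exact ⟨r + r', fun e he => by rw [add_smul, add_smul, hr e he, hr' e he]⟩
    | mul s t _ _ hs ht =>
      obtain ⟨r, hr⟩ := hs
      obtain ⟨r', hr'⟩ := ht
      refine ⟨r * r', fun e he => ?_⟩
      rw [mul_smul, mul_smul, hr' e he, ← algebraMap_smul S r', hr _ (Submodule.smul_mem _ _ he),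
        algebraMap_smul]
  have hfin : Module.Finite R (killedBy E A) := by
    obtain ⟨G, hG⟩ := (inferInstance : Module.Finite S (killedBy E A)).fg_top
    refine ⟨G, eq_top_iff.2 fun e _ => ?_⟩
    have he : e ∈ Submodule.span S (G : Set (killedBy E A)) := hG ▸ Submodule.mem_top
    induction he using Submodule.span_induction with
    | mem g hg => exact Submodule.subset_span hg
    | zero => exact zero_mem _
    | add y z _ _ hy hz => exact add_mem (hy trivial) (hz trivial)
    | smul s z _ hz =>
      obtain ⟨r, hr⟩ := hs s
      have : s • z = r • z := Subtype.ext (hr z z.2)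
      rw [this]
      exact Submodule.smul_mem _ _ (hz trivial)
  exact isNoetherian_of_isNoetherianRing_of_finite R _

/-- Eventual stability of the associated primes of the components of a graded module. -/
theorem associatedPrimes_eventually_eq [IsNoetherianRing S] [Module.Finite S E] {A : Set S}
    (hA : Algebra.adjoin R A = ⊤) (F : ℕ → Type*) [∀ n, AddCommGroup (F n)] [∀ n, Module R (F n)]
    (ι : ∀ n, F n →ₗ[R] E) (ρ : ∀ n, E →ₗ[R] F n) (hρι : ∀ n x, ρ n (ι n x) = x)
    (hρι' : ∀ m n x, m ≠ n → ρ m (ι n x) = 0)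
    (hAι : ∀ n, ∀ a ∈ A, ∀ x : F n, ∃ y : F (n + 1), a • ι n x = ι (n + 1) y) :
    ∃ (n₁ : ℕ) (T : Set (Ideal R)), T.Finite ∧ ∀ n ≥ n₁, associatedPrimes R (F n) = T := by
  have hι : ∀ n, Function.Injective (ι n) := fun n => Function.LeftInverse.injective (hρι n)
  have hsub : ∀ n, associatedPrimes R (F n) ⊆ associatedPrimes R E := fun n =>
    associatedPrimes.subset_of_injective (hι n)
  obtain ⟨n₀, hn₀⟩ : ∃ n₀, ∀ n ≥ n₀, ∀ x : F n, ι n x ∈ killedBy E A → x = 0 := by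
    have := isNoetherian_killedBy (E := E) hA
    let V : ℕ → Submodule R (killedBy E A) := fun n =>
      (LinearMap.range (ι n)).comap ((killedBy E A).subtype.restrictScalars R)
    have hV : iSupIndep V := by
      intro n
      rw [Submodule.disjoint_def]
      rintro e ⟨x, hx⟩ he
      have h0 : ρ n e = 0 := by
        have : (⨆ m, ⨆ (_ : m ≠ n), V m) ≤
            LinearMap.ker (ρ n ∘ₗ (killedBy E A).subtype.restrictScalars R) := by
          refine iSup₂_le fun m hm => ?_
          rintro f ⟨y, hy⟩
          change ρ n f = 0
          have hy' : ι m y = f := hy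
          rw [← hy', hρι' _ _ _ hm.symm]
        exact this he
      have hx' : ι n x = e := hx
      rw [← hx', hρι] at h0
      exact Subtype.ext (by rw [← hx', h0, map_zero]; rfl)
    obtain ⟨b, hb⟩ := (WellFoundedGT.finite_ne_bot_of_iSupIndep hV).bddAbove
    refine ⟨b + 1, fun n hn x hx => ?_⟩
    have hVn : V n = ⊥ := by
      by_contra h
      have := hb h
      omega
    have hmem : (⟨ι n x, hx⟩ : killedBy E A) ∈ V n := ⟨x, rfl⟩
    rw [hVn, Submodule.mem_bot] at hmem
    exact hι n ((congrArg Subtype.val hmem).trans (map_zero _).symm)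
  obtain ⟨Y, hYA, hY⟩ : ∃ Y : Finset S, (Y : Set S) ⊆ A ∧
      Ideal.span A = Ideal.span (Y : Set S) := by
    obtain ⟨Y, hYA, hY⟩ := (Submodule.fg_span_iff_fg_span_finset_subset A).1
      (IsNoetherian.noetherian (Submodule.span S A))
    exact ⟨Y, hYA, hY⟩
  have hmono : ∀ n ≥ n₀, associatedPrimes R (F n) ⊆ associatedPrimes R (F (n + 1)) := by
    intro n hn p hp
    obtain ⟨hp, x, hx⟩ := mem_associatedPrimes_iff_smul.1 hp
    by_contra hcon
    have : ∀ y ∈ Y, ∃ b ∉ p, b • y • ι n x = 0 := by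
      intro y hy
      by_contra! hb
      obtain ⟨z, hz⟩ := hAι n y (hYA hy) x
      refine hcon (mem_associatedPrimes_iff_smul.2 ⟨hp, z, fun a => ⟨fun ha => ?_, fun ha => ?_⟩⟩)
      · apply hι
        rw [map_smul, ← hz, smul_comm, ← map_smul, (hx a).1 ha, map_zero, smul_zero, map_zero]
      · by_contra hap
        exact hb a hap (by rw [hz, ← map_smul, ha, map_zero])
    choose! b hbp hb using this
    have hprod : (∏ y ∈ Y, b y) ∉ p := fun h => by
      obtain ⟨y, hy, hyp⟩ := hp.prod_mem_iff.1 h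
      exact hbp y hy hyp
    refine hprod ((hx _).2 (hn₀ n hn _ ?_))
    classical
    have hle : Ideal.span A ≤ (⊥ : Submodule S E).colon {ι n ((∏ y ∈ Y, b y) • x)} := by
      rw [hY, Ideal.span_le]
      intro y hy
      rw [SetLike.mem_coe, Submodule.mem_colon_singleton, Submodule.mem_bot, map_smul, smul_comm,
        ← Finset.prod_erase_mul _ _ hy, mul_smul, hb y hy, smul_zero]
    intro a ha
    have := hle (Ideal.subset_span ha)
    rwa [Submodule.mem_colon_singleton, Submodule.mem_bot] at this
  have hmono' : ∀ n ≥ n₀, ∀ m ≥ n, associatedPrimes R (F n) ⊆ associatedPrimes R (F m) := by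
    intro n hn m hm
    induction m, hm using Nat.le_induction with
    | base => exact subset_rfl
    | succ m hm ih => exact ih.trans (hmono m (by omega))
  have hT : (⋃ n ≥ n₀, associatedPrimes R (F n)).Finite :=
    (finite_associatedPrimes_of_finite_algebra (S := S) (E := E)).subset
      (Set.iUnion₂_subset fun n _ => hsub n)
  have hev : ∀ᶠ m in Filter.atTop, ∀ p ∈ ⋃ n ≥ n₀, associatedPrimes R (F n),
      p ∈ associatedPrimes R (F m) := by
    refine (Filter.eventually_all_finite hT).2 fun p hp => ?_
    obtain ⟨n, hn, hpn⟩ := Set.mem_iUnion₂.1 hp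
    exact Filter.eventually_atTop.2 ⟨n, fun m hm => hmono' n hn m hm hpn⟩
  obtain ⟨n₁, hn₁⟩ := Filter.eventually_atTop.1 hev
  refine ⟨max n₀ n₁, _, hT, fun n hn => Set.Subset.antisymm ?_ ?_⟩
  · exact Set.subset_iUnion₂_of_subset n (le_of_max_le_left hn) subset_rfl
  · exact fun p hp => hn₁ n (le_of_max_le_right hn) p hp

end Graded

section GradedComponents

variable {R : Type} [CommRing R] {M : Type*} [AddCommGroup M] [Module R M] (ℳ : ℕ → Submodule R M)
  [DirectSum.Decomposition ℳ]

/-- The projection of a graded module to one of its components. -/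
def gradedProj (n : ℕ) : M →ₗ[R] ℳ n :=
  DirectSum.component R ℕ (fun i => ℳ i) n ∘ₗ (DirectSum.decomposeLinearEquiv ℳ).toLinearMap

lemma gradedProj_of_mem {n : ℕ} {m : M} (hm : m ∈ ℳ n) : gradedProj ℳ n m = ⟨m, hm⟩ :=
  Subtype.ext (DirectSum.decompose_of_mem_same ℳ hm)

lemma gradedProj_of_mem_ne {n i : ℕ} {m : M} (hm : m ∈ ℳ i) (h : i ≠ n) : gradedProj ℳ n m = 0 :=
  Subtype.ext (DirectSum.decompose_of_mem_ne ℳ hm h)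

variable {S : Type*} [CommRing S] [Algebra R S] (𝒜 : ℕ → Submodule R S)
  [Module S M] [IsScalarTower R S M]

lemma gradedProj_smul_mem [GradedAlgebra 𝒜] [SetLike.GradedSMul 𝒜 ℳ]
    (h0 : 𝒜 0 = Subalgebra.toSubmodule (⊥ : Subalgebra R S)) {n : ℕ} (L : Submodule R (ℳ n))
    {v : ℳ n} (hv : v ∈ L) (s : S) : gradedProj ℳ n (s • (v : M)) ∈ L := by
  induction s using DirectSum.Decomposition.inductionOn 𝒜 with
  | zero => simp
  | @homogeneous i a =>
    have hmem : (a : S) • (v : M) ∈ ℳ (i + n) := SetLike.GradedSMul.smul_mem a.2 v.2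
    rcases Nat.eq_zero_or_pos i with rfl | hi
    · have ha : (a : S) ∈ Subalgebra.toSubmodule (⊥ : Subalgebra R S) := h0 ▸ a.2
      obtain ⟨r, hr⟩ := Algebra.mem_bot.1 ha
      rw [← hr, algebraMap_smul, map_smul, gradedProj_of_mem ℳ v.2]
      exact L.smul_mem r hv
    · rw [gradedProj_of_mem_ne ℳ hmem (by omega)]
      exact L.zero_mem
  | add s t hs ht =>
    rw [add_smul, map_add]
    exact L.add_mem hs ht

lemma isNoetherian_gradedComponent [GradedAlgebra 𝒜] [SetLike.GradedSMul 𝒜 ℳ] [IsNoetherian S M]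
    (h0 : 𝒜 0 = Subalgebra.toSubmodule (⊥ : Subalgebra R S)) (n : ℕ) : IsNoetherian R (ℳ n) := by
  let Φ : Submodule R (ℳ n) → Submodule S M := fun L => Submodule.span S ((ℳ n).subtype '' L)
  have hΦ : ∀ L (v : ℳ n), (v : M) ∈ Φ L → v ∈ L := by
    intro L v hv
    have key : ∀ m ∈ Φ L, ∀ s : S, gradedProj ℳ n (s • m) ∈ L := by
      intro m hm
      induction hm using Submodule.span_induction with
      | mem m hm =>
        obtain ⟨v, hv, rfl⟩ := hm
        exact gradedProj_smul_mem ℳ 𝒜 h0 L hv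
      | zero => simp
      | add x y _ _ hx hy =>
        intro s
        rw [smul_add, map_add]
        exact L.add_mem (hx s) (hy s)
      | smul t x _ hx =>
        intro s
        rw [smul_smul]
        exact hx _
    have := key _ hv 1
    rwa [one_smul, gradedProj_of_mem ℳ v.2] at this
  let Ψ : Submodule R (ℳ n) ↪o Submodule S M := OrderEmbedding.ofMapLEIff Φ fun L L' =>
    ⟨fun h v hv => hΦ L' v (h (Submodule.subset_span ⟨v, hv, rfl⟩)),
      fun h => Submodule.span_mono (Set.image_mono h)⟩
  exact isNoetherian_iff'.2 Ψ.wellFoundedGT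

variable (S) in
lemma mem_smul_top_of_mem_map_smul_top (J : Ideal R) {m : M}
    (hm : m ∈ (J.map (algebraMap R S) • ⊤ : Submodule S M)) : m ∈ (J • ⊤ : Submodule R M) := by
  refine Submodule.smul_induction_on hm (fun s hs m _ => ?_) (fun _ _ => add_mem)
  induction hs using Submodule.span_induction generalizing m with
  | mem s hs =>
    obtain ⟨r, hr, rfl⟩ := hs
    rw [algebraMap_smul]
    exact Submodule.smul_mem_smul hr trivial
  | zero => simp
  | add s t _ _ hs ht =>
    rw [add_smul]
    exact add_mem (hs m trivial) (ht m trivial)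
  | smul t s _ hs =>
    rw [smul_assoc, smul_comm]
    exact hs _ trivial

/-- Eventual stability of the associated primes of `N_n / J N_n`, for the components `N_n` of a
finitely generated graded module. -/
theorem associatedPrimes_quotient_gradedComponent_eventually_eq
    [SetLike.GradedSMul 𝒜 ℳ] [IsNoetherianRing R] [IsNoetherianRing S] [Module.Finite S M]
    (hstd : Algebra.adjoin R (𝒜 1 : Set S) = ⊤) (J : Ideal R) :
    ∃ (n₁ : ℕ) (T : Set (Ideal R)), T.Finite ∧
      ∀ n ≥ n₁, associatedPrimes R (ℳ n ⧸ (J • ⊤ : Submodule R (ℳ n))) = T := by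
  let W : Submodule S M := J.map (algebraMap R S) • ⊤
  have hι : ∀ n, (J • ⊤ : Submodule R (ℳ n)) ≤
      LinearMap.ker ((W.mkQ.restrictScalars R) ∘ₗ (ℳ n).subtype) := by
    intro n
    refine Submodule.smul_le.2 fun r hr v _ => ?_
    refine (Submodule.Quotient.mk_eq_zero W).2 ?_
    change r • (v : M) ∈ W
    rw [← algebraMap_smul S]
    exact Submodule.smul_mem_smul (Ideal.mem_map_of_mem _ hr) trivial
  have hρ : ∀ n, W.restrictScalars R ≤
      LinearMap.ker ((J • ⊤ : Submodule R (ℳ n)).mkQ ∘ₗ gradedProj ℳ n) := by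
    intro n m hm
    refine (Submodule.Quotient.mk_eq_zero _).2 ?_
    have h1 : gradedProj ℳ n m ∈ (J • ⊤ : Submodule R M).map (gradedProj ℳ n) :=
      ⟨m, mem_smul_top_of_mem_map_smul_top S J hm, rfl⟩
    rw [Submodule.map_smul''] at h1
    exact Submodule.smul_mono le_rfl le_top h1
  refine associatedPrimes_eventually_eq (E := M ⧸ W) hstd _
    (fun n => Submodule.liftQ _ _ (hι n))
    (fun n => Submodule.liftQ _ _ (hρ n) ∘ₗ
      (Submodule.Quotient.restrictScalarsEquiv R W).symm.toLinearMap) ?_ ?_ ?_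
  · intro n x
    obtain ⟨v, rfl⟩ := Submodule.Quotient.mk_surjective _ x
    change Submodule.Quotient.mk (gradedProj ℳ n v) = _
    rw [gradedProj_of_mem ℳ v.2]
  · intro m n x hmn
    obtain ⟨v, rfl⟩ := Submodule.Quotient.mk_surjective _ x
    change Submodule.Quotient.mk (gradedProj ℳ m v) = _
    rw [gradedProj_of_mem_ne ℳ v.2 hmn.symm]
    rfl
  · intro n a ha x
    obtain ⟨v, rfl⟩ := Submodule.Quotient.mk_surjective _ x
    refine ⟨Submodule.Quotient.mk ⟨a • (v : M), ?_⟩, rfl⟩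
    rw [add_comm]
    exact SetLike.GradedSMul.smul_mem ha v.2

end GradedComponents

section SequencesInDimension

variable {R : Type} [CommRing R]

/-- The ideal generated by the entries of `x` of index less than `j`. -/
def initialIdeal (x : ℕ → R) (j : ℕ) : Ideal R :=
  Ideal.span (x '' Set.Iio j)

lemma initialIdeal_succ (x : ℕ → R) (j : ℕ) :
    initialIdeal x (j + 1) = initialIdeal x j ⊔ Ideal.span {x j} := by
  rw [initialIdeal, initialIdeal, ← Ideal.span_union, ← Set.image_singleton, ← Set.image_union]
  congr 2
  ext i
  simp only [Set.mem_Iio, Set.mem_union, Set.mem_singleton_iff]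
  omega

lemma initialIdeal_zero (x : ℕ → R) : initialIdeal x 0 = ⊥ := by
  simp [initialIdeal]

lemma initialIdeal_congr {x y : ℕ → R} {j : ℕ} (h : ∀ i < j, x i = y i) :
    initialIdeal x j = initialIdeal y j := by
  have : x '' Set.Iio j = y '' Set.Iio j := Set.image_congr fun i hi => h i hi
  rw [initialIdeal, initialIdeal, this]

lemma prefIdeal_eq_initialIdeal {r : ℕ} (x : Fin r → R) {j : ℕ} (hj : j ≤ r) :
    prefIdeal x j = initialIdeal (fun i => if h : i < r then x ⟨i, h⟩ else 0) j := by
  rw [prefIdeal, initialIdeal]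
  congr 1
  ext a
  constructor
  · rintro ⟨i, hi, rfl⟩
    exact ⟨i, hi, by simp⟩
  · rintro ⟨i, hi, rfl⟩
    have hir : i < r := lt_of_lt_of_le hi hj
    exact ⟨⟨i, hir⟩, hi, by simp [hir]⟩

/-- The first `l` entries of `x` form an `N`-sequence in dimension `> k`. -/
def IsInitialSeqInDimGT (k : ℤ) (N : Type) [AddCommGroup N] [Module R N] (x : ℕ → R)
    (l : ℕ) : Prop :=
  ∀ i < l, ∀ p ∈ associatedPrimes R (N ⧸ (initialIdeal x i • ⊤ : Submodule R N)),
    zdim k < ringKrullDim (R ⧸ p) → x i ∉ p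

lemma exists_isInitialSeqInDimGT_of_le_depthK {k : ℤ} {I : Ideal R} {N : Type} [AddCommGroup N]
    [Module R N] {l : ℕ} (hl : (l : ℕ∞) ≤ depthK R k I N) :
    ∃ y : ℕ → R, (∀ i < l, y i ∈ I) ∧ IsInitialSeqInDimGT k N y l := by
  rcases l with _ | l
  · exact ⟨0, by simp, fun i hi => absurd hi (Nat.not_lt_zero i)⟩
  · have hlt : (l : ℕ∞) < depthK R k I N := lt_of_lt_of_le (by exact_mod_cast l.lt_succ_self) hl
    obtain ⟨_, ⟨r, x, hxI, hx, rfl⟩, hlr⟩ := lt_sSup_iff.1 hlt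
    have hlr : l < r := by exact_mod_cast hlr
    refine ⟨fun i => if h : i < r then x ⟨i, h⟩ else 0, fun i hi => ?_, fun i hi => ?_⟩
    · have hir : i < r := by omega
      simpa only [hir, dif_pos] using hxI _
    · have hir : i < r := by omega
      rw [← prefIdeal_eq_initialIdeal x hir.le]
      simpa only [hir, dif_pos] using hx ⟨i, hir⟩

lemma zdim_lt_ringKrullDim_quotient_of_lt [IsNoetherianRing R] [IsLocalRing R] {k : ℤ}
    {p q : Ideal R} [hp : p.IsPrime] [q.IsPrime] (hqp : q < p)
    (h : zdim k ≤ ringKrullDim (R ⧸ p)) : zdim k < ringKrullDim (R ⧸ q) := by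
  obtain ⟨a, hap, haq⟩ := Set.exists_of_ssubset hqp
  have h1 : ringKrullDim (R ⧸ p) + 1 ≤ ringKrullDim (R ⧸ q) :=
    ringKrullDim_succ_le_of_surjective (Ideal.Quotient.factor hqp.le)
      (Ideal.Quotient.factor_surjective hqp.le) (r := Ideal.Quotient.mk q a)
      (mem_nonZeroDivisors_of_ne_zero fun h => haq (Ideal.Quotient.eq_zero_iff_mem.1 h))
      (Ideal.Quotient.eq_zero_iff_mem.2 hap)
  refine lt_of_le_of_lt h (lt_of_lt_of_le ?_ h1)
  have htop : ringKrullDim (R ⧸ p) < ⊤ :=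
    (ringKrullDim_quotient_le p).trans_lt ringKrullDim_lt_top
  have hbot : ⊥ < ringKrullDim (R ⧸ p) := by
    have : Nontrivial (R ⧸ p) := Ideal.Quotient.nontrivial_iff.2 hp.ne_top
    exact lt_of_lt_of_le (WithBot.bot_lt_coe 0) ringKrullDim_nonneg_of_nontrivial
  generalize ringKrullDim (R ⧸ p) = d at htop hbot
  lift d to ℕ∞ using hbot.ne'
  have : d ≠ ⊤ := by rintro rfl; exact absurd htop (lt_irrefl _)
  lift d to ℕ using this
  exact WithBot.coe_lt_coe.2 (by exact_mod_cast Nat.lt_succ_self d : (d : ℕ∞) < (d : ℕ∞) + 1)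

lemma exact_smul_factor_initialIdeal (N : Type) [AddCommGroup N] [Module R N] (x : ℕ → R) (j : ℕ)
    (h : (initialIdeal x j • ⊤ : Submodule R N) ≤ initialIdeal x (j + 1) • ⊤) :
    Function.Exact (x j • LinearMap.id : (N ⧸ (initialIdeal x j • ⊤ : Submodule R N)) →ₗ[R] _)
      (Submodule.factor h) := by
  intro v
  obtain ⟨v, rfl⟩ := Submodule.Quotient.mk_surjective _ v
  change Submodule.Quotient.mk v = 0 ↔ _
  rw [Submodule.Quotient.mk_eq_zero, initialIdeal_succ, Submodule.sup_smul, Submodule.mem_sup]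
  constructor
  · rintro ⟨u, hu, w, hw, rfl⟩
    rw [Submodule.ideal_span_singleton_smul, Submodule.mem_smul_pointwise_iff_exists] at hw
    obtain ⟨n, -, rfl⟩ := hw
    refine ⟨Submodule.Quotient.mk n, (Submodule.Quotient.eq _).2 ?_⟩
    rw [← neg_mem_iff]
    change -(x j • n - (u + x j • n)) ∈ _
    simpa using hu
  · rintro ⟨w, hw⟩
    obtain ⟨w, rfl⟩ := Submodule.Quotient.mk_surjective _ w
    have hw : Submodule.Quotient.mk (x j • w) = Submodule.Quotient.mk v := hw
    refine ⟨v - x j • w, (Submodule.Quotient.eq _).1 hw.symm, x j • w,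
      Submodule.smul_mem_smul (Ideal.mem_span_singleton_self _) trivial, sub_add_cancel _ _⟩

variable [IsNoetherianRing R] [IsLocalRing R]

/-- Associated primes of dimension at least `k` of local cohomology in degrees `≤ l`, for a module
admitting a sequence of length `l` in dimension `> k`. -/
lemma exists_mem_associatedPrimes_lc_iff_quotient {k : ℤ} {I : Ideal R} {N : Type} [AddCommGroup N]
    [Module R N] [Module.Finite R N] {x : ℕ → R} {l : ℕ} (hxI : ∀ i < l, x i ∈ I)
    (hx : IsInitialSeqInDimGT k N x l) {p : Ideal R} [p.IsPrime] (hIp : I ≤ p)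
    (hp : zdim k ≤ ringKrullDim (R ⧸ p)) :
    (∃ j ≤ l, p ∈ associatedPrimes R ((localCohomology I j).obj (ModuleCat.of R N))) ↔
      ∃ j ≤ l, p ∈ associatedPrimes R (N ⧸ (initialIdeal x j • ⊤ : Submodule R N)) := by
  have hle : ∀ j, (initialIdeal x j • ⊤ : Submodule R N) ≤ initialIdeal x (j + 1) • ⊤ :=
    fun j => Submodule.smul_mono_left (initialIdeal_succ x j ▸ le_sup_left)
  rw [← exists_mem_associatedPrimes_lc_iff I l
    (fun j => N ⧸ (initialIdeal x j • ⊤ : Submodule R N)) (fun j => Submodule.factor (hle j)) x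
    (fun j => Submodule.factor_surjective (hle j))
    (fun j => exact_smul_factor_initialIdeal N x j (hle j)) hxI p hIp ?_]
  · have h0 : (initialIdeal x 0 • ⊤ : Submodule R N) = ⊥ := by
      rw [initialIdeal_zero, Submodule.bot_smul]
    have heq : ∀ j, associatedPrimes R ((localCohomology I j).obj (ModuleCat.of R
        (N ⧸ (initialIdeal x 0 • ⊤ : Submodule R N)))) =
        associatedPrimes R ((localCohomology I j).obj (ModuleCat.of R N)) := fun j =>
      LinearEquiv.AssociatedPrimes.eq ((localCohomology I j).mapIso
        (Submodule.quotEquivOfEqBot _ h0).toModuleIso).toLinearEquiv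
    simp only [heq]
  · intro i hi q hq hqp
    have : q.IsPrime := hq.1
    exact hx i hi q hq (zdim_lt_ringKrullDim_quotient_of_lt hqp hp)

/-- If the modules `N n / J N n` have stable associated primes and the `N n` admit sequences of
length `l` in dimension `> k`, there is a common sequence for all large `n`. -/
lemma exists_eventually_isInitialSeqInDimGT {k : ℤ} {I : Ideal R} {N : ℕ → Type}
    [∀ n, AddCommGroup (N n)] [∀ n, Module R (N n)] [∀ n, Module.Finite R (N n)]
    (hstab : ∀ J : Ideal R, ∃ (n₁ : ℕ) (T : Set (Ideal R)), T.Finite ∧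
      ∀ n ≥ n₁, associatedPrimes R (N n ⧸ (J • ⊤ : Submodule R (N n))) = T)
    {l n₀ : ℕ} (hseq : ∀ n ≥ n₀, ∃ y : ℕ → R, (∀ i < l, y i ∈ I) ∧
      IsInitialSeqInDimGT k (N n) y l) {j : ℕ} (hj : j ≤ l) :
    ∃ x : ℕ → R, (∀ i < j, x i ∈ I) ∧
      ∃ n₁, ∀ n ≥ n₁, IsInitialSeqInDimGT k (N n) x j := by
  induction j with
  | zero => exact ⟨0, by simp, 0, fun n _ i hi => absurd hi (Nat.not_lt_zero i)⟩
  | succ j ih =>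
    obtain ⟨x, hxI, n₁, hx⟩ := ih (by omega)
    obtain ⟨n₂, T, hT, hn₂⟩ := hstab (initialIdeal x j)
    have hTI : ∀ q ∈ T, zdim k < ringKrullDim (R ⧸ q) → ¬ I ≤ q := by
      intro q hq hdim hIq
      let n := max n₀ (max n₁ n₂)
      have hqn := hn₂ n (by omega) ▸ hq
      have : q.IsPrime := hqn.1
      obtain ⟨y, hyI, hy⟩ := hseq n (by omega)
      obtain ⟨i, hi, hqi⟩ := (exists_mem_associatedPrimes_lc_iff_quotient hxI (hx n (by omega))
        hIq hdim.le).2 ⟨j, le_rfl, hqn⟩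
      obtain ⟨i', hi', hqi'⟩ := (exists_mem_associatedPrimes_lc_iff_quotient
        (fun i hi => hyI i (by omega)) (fun i hi => hy i (by omega)) hIq hdim.le).1
        ⟨i, hi, hqi⟩
      exact hy i' (by omega) q hqi' hdim (hIq (hyI i' (by omega)))
    have hprime : ∀ q ∈ T, q.IsPrime := fun q hq => (hn₂ n₂ le_rfl ▸ hq).1
    obtain ⟨z, hzI, hz⟩ : ∃ z ∈ I, ∀ q ∈ T, zdim k < ringKrullDim (R ⧸ q) → z ∉ q := by
      have := (Ideal.subset_union_prime_finite (f := id) (I := I)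
        (hT.subset (Set.sep_subset T fun q => zdim k < ringKrullDim (R ⧸ q))) 0 0
        fun q hq _ _ => hprime q hq.1).not.2 (by
          rintro ⟨q, hq, hIq⟩
          exact hTI q hq.1 hq.2 hIq)
      obtain ⟨z, hzI, hz⟩ := Set.not_subset.1 this
      refine ⟨z, hzI, fun q hq hdim hzq => hz ?_⟩
      exact Set.mem_biUnion (x := q) ⟨hq, hdim⟩ hzq
    have hne : ∀ i < j, Function.update x j z i = x i := fun i hi =>
      Function.update_of_ne hi.ne _ _
    refine ⟨Function.update x j z, fun i hi => ?_, max n₁ n₂, fun n hn i hi => ?_⟩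
    · rcases Nat.lt_succ_iff_lt_or_eq.1 hi with hi | rfl
      · exact hne i hi ▸ hxI i hi
      · rwa [Function.update_self]
    · rw [initialIdeal_congr (fun i' hi' => hne i' (by omega))]
      rcases Nat.lt_succ_iff_lt_or_eq.1 hi with hi | rfl
      · rw [hne i hi]
        exact hx n (by omega) i hi
      · rw [Function.update_self, hn₂ n (by omega)]
        exact hz

/-- Stability of the associated primes of dimension at least `k` of local cohomology, for a family
of modules whose quotients `N n / J N n` have stable associated primes. -/
theorem associatedPrimes_lc_inter_dimGE_eventually_eq {k : ℤ} {I : Ideal R} {N : ℕ → Type}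
    [∀ n, AddCommGroup (N n)] [∀ n, Module R (N n)] [∀ n, Module.Finite R (N n)]
    (hstab : ∀ J : Ideal R, ∃ (n₁ : ℕ) (T : Set (Ideal R)), T.Finite ∧
      ∀ n ≥ n₁, associatedPrimes R (N n ⧸ (J • ⊤ : Submodule R (N n))) = T)
    {l n₀ : ℕ} (hdepth : ∀ n ≥ n₀, (l : ℕ∞) ≤ depthK R k I (N n)) :
    ∃ (n₁ : ℕ) (T : Set (Ideal R)), T.Finite ∧ ∀ n ≥ n₁,
      (⋃ j ≤ l, associatedPrimes R
          ((localCohomology I j).obj (ModuleCat.of R (N n))) ∩ dimGE R k) = T := by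
  obtain ⟨x, hxI, n₁, hx⟩ := exists_eventually_isInitialSeqInDimGT hstab
    (fun n hn => exists_isInitialSeqInDimGT_of_le_depthK (hdepth n hn)) le_rfl
  choose m T hT hm using fun j => hstab (initialIdeal x j)
  refine ⟨max n₁ ((Finset.range (l + 1)).sup m),
    {p | I ≤ p ∧ p ∈ dimGE R k ∧ ∃ j ≤ l, p ∈ T j}, ?_, fun n hn => ?_⟩
  · refine ((Set.finite_Iic l).biUnion fun j _ => hT j).subset ?_
    rintro p ⟨-, -, j, hj, hp⟩
    exact Set.mem_biUnion (x := j) hj hp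
  · have hTn : ∀ j ≤ l, associatedPrimes R
        (N n ⧸ (initialIdeal x j • ⊤ : Submodule R (N n))) = T j := fun j hj =>
      hm j n ((Finset.le_sup (Finset.mem_range.2 (Nat.lt_succ_of_le hj))).trans
        ((le_max_right _ _).trans hn))
    have key := fun (p : Ideal R) (hp : p.IsPrime) => exists_mem_associatedPrimes_lc_iff_quotient
      hxI (hx n ((le_max_left _ _).trans hn)) (p := p)
    ext p
    simp only [Set.mem_iUnion, Set.mem_inter_iff, exists_prop, Set.mem_ofPred_eq]
    constructor
    · rintro ⟨j, hj, hp, hdim⟩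
      have hIp := le_of_mem_associatedPrimes_lc j hp
      obtain ⟨i, hi, hpi⟩ := (key p hp.1 hIp hdim).1 ⟨j, hj, hp⟩
      exact ⟨hIp, hdim, i, hi, hTn i hi ▸ hpi⟩
    · rintro ⟨hIp, hdim, i, hi, hpi⟩
      rw [← hTn i hi] at hpi
      obtain ⟨j, hj, hp⟩ := (key p hpi.1 hIp hdim).2 ⟨i, hi, hpi⟩
      exact ⟨j, hj, hp, hdim⟩

end SequencesInDimension

/-- Theorem 1.2: with `r` the eventual value of `depth_k(I, N_n)`, for each `l ≤ r` the set
`⋃_{j≤l} Ass_R(H^j_I(N_n))_{≥k}` is finite and stable for large `n`. -/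
theorem ass_localCohomology_graded_stable (R : Type) [CommRing R] [IsNoetherianRing R]
    [IsLocalRing R] (I : Ideal R)
    (S : Type) [CommRing S] [Algebra R S] [Algebra.FiniteType R S]
    (𝒜 : ℕ → Submodule R S) [GradedAlgebra 𝒜]
    (hstd : Algebra.adjoin R (𝒜 1 : Set S) = ⊤)
    (h0 : 𝒜 0 = Subalgebra.toSubmodule (⊥ : Subalgebra R S))
    (M : Type) [AddCommGroup M] [Module R M] [Module S M] [IsScalarTower R S M]
    (ℳ : ℕ → Submodule R M) [SetLike.GradedSMul 𝒜 ℳ] [DirectSum.Decomposition ℳ]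
    [Module.Finite S M]
    (k : ℤ) (hk : -1 ≤ k) (r : ℕ∞)
    (hev : ∃ n₀ : ℕ, ∀ n ≥ n₀, depthK R k I (ℳ n) = r)
    (l : ℕ) (hl : (l : ℕ∞) ≤ r) :
    ∃ (n₁ : ℕ) (T : Set (Ideal R)), T.Finite ∧ ∀ n ≥ n₁,
      (⋃ j ≤ l, associatedPrimes R
          ((localCohomology I j).obj (ModuleCat.of R (ℳ n))) ∩ dimGE R k) = T := by
  have hS : IsNoetherianRing S := Algebra.FiniteType.isNoetherianRing R S
  have hfin : ∀ n, Module.Finite R (ℳ n) := fun n =>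
    have := isNoetherian_gradedComponent ℳ 𝒜 h0 n
    inferInstance
  obtain ⟨n₀, hn₀⟩ := hev
  exact associatedPrimes_lc_inter_dimGE_eventually_eq
    (associatedPrimes_quotient_gradedComponent_eventually_eq ℳ 𝒜 hstd)
    fun n hn => (hn₀ n hn).symm ▸ hl
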